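/- Let P : C →_A C' be an execution step and let u be a node with u ∈ A_h and children'(u) ∩ A_b = ∅. Then u ∉ B'. -/

import Mathlib

open scoped Classical

/-- A pre-configuration: a finite node set `V` with a partial parent map
(`none` means the node has no parent) and an integer height assignment. -/
structure PreConfig (V : Type*) where
  parent : V → Option V
  height : V → ℤ

namespace PreConfig

variable {V : Type*} [Fintype V] [LinearOrder V]

/-- The children of `u` are the nodes whose parent is `u`. -/
noncomputable def children (C : PreConfig V) (u : V) : Finset V :=
  Finset.univ.filter (fun v => C.parent v = some u)

/-- A leaf is a node with no children. -/
def IsLeaf (C : PreConfig V) (u : V) : Prop := C.children u = ∅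

/-- Maximum height value among the children of `u` (junk value `0` for a leaf). -/
noncomputable def maxH (C : PreConfig V) (u : V) : ℤ :=
  if h : (C.children u).Nonempty then (C.children u).sup' h C.height else 0

/-- Minimum height value among the children of `u` (junk value `0` for a leaf). -/
noncomputable def minH (C : PreConfig V) (u : V) : ℤ :=
  if h : (C.children u).Nonempty then (C.children u).inf' h C.height else 0

/-- A child of `u` of maximum height value; ties broken by a fixed rule
(smallest ID). Junk value `u` for a leaf. -/
noncomputable def maxChild (C : PreConfig V) (u : V) : V :=
  if h : ((C.children u).filter fun v => C.height v = C.maxH u).Nonempty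
  then ((C.children u).filter fun v => C.height v = C.maxH u).min' h else u

/-- A child of `u` of minimum height value; ties broken by a fixed rule
(smallest ID). Junk value `u` for a leaf. -/
noncomputable def minChild (C : PreConfig V) (u : V) : V :=
  if h : ((C.children u).filter fun v => C.height v = C.minH u).Nonempty
  then ((C.children u).filter fun v => C.height v = C.minH u).min' h else u

/-- `stable(u)`: `h(u) = 0` if `u` is a leaf, and `h(u) = 1 + max_{w child of u} h(w)` otherwise. -/
def Stable (C : PreConfig V) (u : V) : Prop :=
  (C.IsLeaf u ∧ C.height u = 0) ∨ (¬ C.IsLeaf u ∧ C.height u = 1 + C.maxH u)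

/-- `balanced(u)`: `|h(z) − h(z')| ≤ α` for all children `z, z'` of `u`. -/
def Balanced (α : ℤ) (C : PreConfig V) (u : V) : Prop :=
  ∀ z ∈ C.children u, ∀ z' ∈ C.children u, |C.height z - C.height z'| ≤ α

/-- `u` is enabled for a height update iff `¬stable(u)`. -/
def UpdateEnabled (C : PreConfig V) (u : V) : Prop := ¬ C.Stable u

/-- `u` is enabled for a swap iff `stable(u) ∧ stable(max(u)) ∧ ¬balanced(u)`. -/
def SwapEnabled (α : ℤ) (C : PreConfig V) (u : V) : Prop :=
  C.Stable u ∧ C.Stable (C.maxChild u) ∧ ¬ Balanced α C u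

/-- `u` is enabled iff it is enabled for a height update or for a swap. -/
def Enabled (α : ℤ) (C : PreConfig V) (u : V) : Prop :=
  C.UpdateEnabled u ∨ SwapEnabled α C u

/-- The value written by a height update: `0` for a leaf, `1 + max_{w child of u} h(w)` otherwise. -/
noncomputable def newHeight (C : PreConfig V) (u : V) : ℤ :=
  if C.IsLeaf u then 0 else 1 + C.maxH u

/-- A bad node: an internal node `u` with `h(u) ≤ max_{v child of u} h(v)`,
or a leaf `u` with `h(u) < 0`. -/
def Bad (C : PreConfig V) (u : V) : Prop :=
  (¬ C.IsLeaf u ∧ C.height u ≤ C.maxH u) ∨ (C.IsLeaf u ∧ C.height u < 0)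

/-- `v` reaches `a` by iterating the parent map. -/
def Reaches (C : PreConfig V) (v a : V) : Prop :=
  Relation.ReflTransGen (fun x y => C.parent x = some y) v a

/-- The underlying graph is a rooted tree with root `r`: `r` has no parent,
every other node has a (unique) parent, and every node reaches `r` by
iterating the parent map. -/
def IsTree (C : PreConfig V) (r : V) : Prop :=
  C.parent r = none ∧ (∀ v, C.parent v = none → v = r) ∧ ∀ v, C.Reaches v r

/-- The subtree `S_u` of `u`: the set of descendants of `u` (including `u`). -/
def subtree (C : PreConfig V) (u : V) : Set V := {v | C.Reaches v u}

/-- The actual height `h*(u)` of `u`: the length of a longest directed path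
going downward from `u` (such a maximal path necessarily ends at a leaf of `S_u`). -/
noncomputable def hstar (C : PreConfig V) (u : V) : ℕ :=
  sSup {n : ℕ | ∃ f : ℕ → V, f 0 = u ∧ ∀ i < n, C.parent (f (i + 1)) = some (f i)}

/-- An execution step `C →_A C'`: a nonempty set `A` of nodes enabled in `C` is
activated simultaneously; each `u ∈ A` enabled for a height update sets its height
to `newHeight`; each `u ∈ A` enabled for a swap replaces the edges `(u, min(u))` and
`(max(u), max(max(u)))` by `(u, max(max(u)))` and `(max(u), min(u))` (all guards and
functions evaluated in `C`); everything else is unchanged. -/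
structure Step (α : ℤ) (C C' : PreConfig V) (A : Finset V) : Prop where
  nonempty : A.Nonempty
  all_enabled : ∀ u ∈ A, Enabled α C u
  height_update : ∀ u ∈ A, C.UpdateEnabled u → C'.height u = C.newHeight u
  height_keep : ∀ u, ¬ (u ∈ A ∧ C.UpdateEnabled u) → C'.height u = C.height u
  swap_out : ∀ u ∈ A, SwapEnabled α C u → C'.parent (C.minChild u) = some (C.maxChild u)
  swap_in : ∀ u ∈ A, SwapEnabled α C u → C'.parent (C.maxChild (C.maxChild u)) = some u
  parent_keep : ∀ v, (∀ u ∈ A, SwapEnabled α C u →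
      v ≠ C.minChild u ∧ v ≠ C.maxChild (C.maxChild u)) → C'.parent v = C.parent v

end PreConfig

namespace PreConfig

variable {V : Type*} [Fintype V] [LinearOrder V]

theorem mem_children {C : PreConfig V} {u v : V} : v ∈ C.children u ↔ C.parent v = some u := by
  simp [children]

theorem not_isLeaf_of_mem {C : PreConfig V} {u v : V} (h : v ∈ C.children u) : ¬ C.IsLeaf u :=
  Finset.ne_empty_of_mem h

theorem height_le_maxH {C : PreConfig V} {u v : V} (h : v ∈ C.children u) :
    C.height v ≤ C.maxH u := by
  rw [maxH, dif_pos ⟨v, h⟩]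
  exact Finset.le_sup' C.height h

theorem exists_height_eq_maxH {C : PreConfig V} {u : V} (h : ¬ C.IsLeaf u) :
    ∃ v ∈ C.children u, C.height v = C.maxH u := by
  have hne : (C.children u).Nonempty := Finset.nonempty_iff_ne_empty.mpr h
  obtain ⟨v, hv, he⟩ := Finset.exists_mem_eq_sup' hne C.height
  exact ⟨v, hv, by rw [maxH, dif_pos hne, he]⟩

theorem exists_height_eq_minH {C : PreConfig V} {u : V} (h : ¬ C.IsLeaf u) :
    ∃ v ∈ C.children u, C.height v = C.minH u := by
  have hne : (C.children u).Nonempty := Finset.nonempty_iff_ne_empty.mpr h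
  obtain ⟨v, hv, he⟩ := Finset.exists_mem_eq_inf' hne C.height
  exact ⟨v, hv, by rw [minH, dif_pos hne, he]⟩

theorem maxChild_mem {C : PreConfig V} {u : V} (h : ¬ C.IsLeaf u) :
    C.maxChild u ∈ C.children u := by
  obtain ⟨v, hv, he⟩ := exists_height_eq_maxH h
  have hne : ((C.children u).filter fun v => C.height v = C.maxH u).Nonempty :=
    ⟨v, Finset.mem_filter.mpr ⟨hv, he⟩⟩
  rw [maxChild, dif_pos hne]
  exact (Finset.mem_filter.mp (Finset.min'_mem _ hne)).1

theorem minChild_mem {C : PreConfig V} {u : V} (h : ¬ C.IsLeaf u) :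
    C.minChild u ∈ C.children u := by
  obtain ⟨v, hv, he⟩ := exists_height_eq_minH h
  have hne : ((C.children u).filter fun v => C.height v = C.minH u).Nonempty :=
    ⟨v, Finset.mem_filter.mpr ⟨hv, he⟩⟩
  rw [minChild, dif_pos hne]
  exact (Finset.mem_filter.mp (Finset.min'_mem _ hne)).1

theorem maxChild_of_isLeaf {C : PreConfig V} {u : V} (h : C.IsLeaf u) : C.maxChild u = u := by
  have h' : C.children u = ∅ := h
  simp [maxChild, h']

theorem SwapEnabled.not_isLeaf {α : ℤ} {C : PreConfig V} {u : V} (h : SwapEnabled α C u) :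
    ¬ C.IsLeaf u := by
  intro hl
  have hl' : C.children u = ∅ := hl
  exact h.2.2 (by simp [Balanced, hl'])

/-- An update of a node that is not bad does not increase its height. -/
theorem newHeight_le_of_not_bad {C : PreConfig V} {u : V} (h : ¬ C.Bad u) :
    C.newHeight u ≤ C.height u := by
  unfold Bad at h
  unfold newHeight
  split_ifs with hl
  · by_contra hlt
    exact h (Or.inr ⟨hl, by omega⟩)
  · by_contra hlt
    exact h (Or.inl ⟨hl, by omega⟩)

/-- An unstable node is neither the source nor the target of a swap, so a step
leaves its set of children unchanged. -/
theorem Step.children_eq {α : ℤ} {C C' : PreConfig V} {A : Finset V} (hstep : Step α C C' A)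
    {u : V} (hu : C.UpdateEnabled u) : C'.children u = C.children u := by
  ext v
  rw [mem_children, mem_children]
  by_cases hv : ∀ w ∈ A, SwapEnabled α C w →
      v ≠ C.minChild w ∧ v ≠ C.maxChild (C.maxChild w)
  · rw [hstep.parent_keep v hv]
  push Not at hv
  obtain ⟨w, hwA, hw, hvw⟩ := hv
  have hwu : w ≠ u := by rintro rfl; exact hu hw.1
  have hmu : C.maxChild w ≠ u := by rintro rfl; exact hu hw.2.1
  by_cases hmin : v = C.minChild w
  · have h' := hstep.swap_out w hwA hw
    have h := mem_children.mp (minChild_mem hw.not_isLeaf)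
    rw [hmin, h', h]
    simp [hwu, hmu]
  · have hmax := hvw hmin
    have h' := hstep.swap_in w hwA hw
    rw [hmax, h']
    by_cases hl : C.IsLeaf (C.maxChild w)
    · rw [maxChild_of_isLeaf hl, mem_children.mp (maxChild_mem hw.not_isLeaf)]
    · rw [mem_children.mp (maxChild_mem hl)]
      simp [hwu, hmu]

/-- Only the update of a bad node can increase a height. -/
theorem Step.height_le {α : ℤ} {C C' : PreConfig V} {A : Finset V} (hstep : Step α C C' A)
    {v : V} (hv : ¬ (v ∈ A ∧ C.Bad v ∧ C.UpdateEnabled v)) : C'.height v ≤ C.height v := by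
  by_cases h : v ∈ A ∧ C.UpdateEnabled v
  · rw [hstep.height_update v h.1 h.2]
    exact newHeight_le_of_not_bad fun hb => hv ⟨h.1, hb, h.2⟩
  · exact (hstep.height_keep v h).le

end PreConfig

/-- Let `C →_A C'` be an execution step and `u` a node with `u ∈ A_h`
(a non-bad activated node performing a height update) and `children'(u) ∩ A_b = ∅`.
Then `u ∉ B'`. -/
theorem stmt12 {V : Type*} [Fintype V] [LinearOrder V] (α : ℤ) (hα : 1 ≤ α)
    (C C' : PreConfig V) (A : Finset V) (r : V)
    (hT : C.IsTree r) (hstep : PreConfig.Step α C C' A)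
    (u : V) (huA : u ∈ A) (huB : ¬ C.Bad u) (huU : C.UpdateEnabled u)
    (hch : ∀ v ∈ C'.children u, ¬ (v ∈ A ∧ C.Bad v ∧ C.UpdateEnabled v)) :
    ¬ C'.Bad u := by
  have hc := hstep.children_eq huU
  have hh := hstep.height_update u huA huU
  rintro (⟨hl, hle⟩ | ⟨hl, hlt⟩)
  · obtain ⟨v, hv, hmax⟩ := PreConfig.exists_height_eq_maxH hl
    have hvC : v ∈ C.children u := hc ▸ hv
    have hv1 := hstep.height_le (hch v hv)
    have hv2 := PreConfig.height_le_maxH hvC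
    rw [PreConfig.newHeight, if_neg (PreConfig.not_isLeaf_of_mem hvC)] at hh
    omega
  · have hlC : C.IsLeaf u := hc.symm.trans hl
    rw [PreConfig.newHeight, if_pos hlC] at hh
    omega
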